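/- Let μ be a Borel probability measure on ℝ whose F-transform F_μ = 1/G_μ is injective on ℂ⁺ and satisfies c·F_μ(ℂ⁺) ⊆ F_μ(ℂ⁺) for every c > 1 (i.e., F_μ is starlike with respect to ∞). Then for every c ∈ (0,1) there exists a Borel probability measure ν on ℝ such that μ = (D_c μ) ▷ ν, i.e., F_μ = F_{D_c μ} ∘ F_ν, where D_c μ is the dilation (D_c μ)(A) = μ(A/c) and ▷ denotes monotone convolution. -/

import Mathlib

open MeasureTheory Complex Set

/-- The reciprocal Cauchy transform (`F`-transform) of a measure on `ℝ`. -/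
noncomputable def Ftrans (μ : MeasureTheory.Measure ℝ) (z : ℂ) : ℂ :=
  (∫ x : ℝ, (z - (x : ℂ))⁻¹ ∂μ)⁻¹

open Filter Topology Metric

/-- **Herglotz representation** of nonnegative harmonic functions on the unit disc. -/
theorem exists_measure_circle_of_harmonicOnNhd {u : ℂ → ℝ}
    (hu : InnerProductSpace.HarmonicOnNhd u (ball 0 1)) (hpos : ∀ w ∈ ball (0 : ℂ) 1, 0 ≤ u w) :
    ∃ m : Measure (sphere (0 : ℂ) 1), IsFiniteMeasure m ∧ ∀ w ∈ ball (0 : ℂ) 1,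
      u w = ∫ ζ : sphere (0 : ℂ) 1, (1 - ‖w‖ ^ 2) / ‖(ζ : ℂ) - w‖ ^ 2 ∂m := by
  have hpi : 0 < 2 * Real.pi := by positivity
  have hcont : ContinuousOn u (ball 0 1) := fun x hx =>
    (hu x hx).1.continuousAt.continuousWithinAt
  set r : ℕ → ℝ := fun n => (n + 1) / (n + 2)
  have hr0 (n : ℕ) : 0 < r n := by positivity
  have hr1 (n : ℕ) : r n < 1 := by simp only [r]; rw [div_lt_one (by positivity)]; linarith
  have hrlim : Tendsto r atTop (𝓝 1) := by
    have h : Tendsto (fun n : ℕ => 1 - 1 / ((n : ℝ) + 1 + 1)) atTop (𝓝 (1 - 0)) :=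
      tendsto_const_nhds.sub
        ((tendsto_add_atTop_iff_nat 1).2 tendsto_one_div_add_atTop_nhds_zero_nat |>.congr
          fun n => by push_cast; rfl)
    rw [sub_zero] at h
    refine h.congr fun n => ?_
    simp only [r]
    field_simp
    ring
  have hmem (n : ℕ) (θ : ℝ) : circleMap 0 (r n) θ ∈ ball (0 : ℂ) 1 := by
    simp [circleMap_zero, abs_of_pos (hr0 n), hr1 n]
  have hd (n : ℕ) : Continuous fun θ => (2 * Real.pi)⁻¹ * u (circleMap 0 (r n) θ) :=
    continuous_const.mul (hcont.comp_continuous (continuous_circleMap 0 (r n)) (hmem n))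
  have hd0 (n : ℕ) (θ : ℝ) : 0 ≤ (2 * Real.pi)⁻¹ * u (circleMap 0 (r n) θ) :=
    mul_nonneg (by positivity) (hpos _ (hmem n θ))
  let e : ℝ → sphere (0 : ℂ) 1 := fun θ => ⟨circleMap 0 1 θ, circleMap_mem_sphere 0 zero_le_one θ⟩
  have he : Measurable e := ((continuous_circleMap 0 1).subtype_mk _).measurable
  let D : ℕ → Measure ℝ := fun n => (volume.restrict (Ioc 0 (2 * Real.pi))).withDensity
    fun θ => ENNReal.ofReal ((2 * Real.pi)⁻¹ * u (circleMap 0 (r n) θ))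
  have hDfin (n : ℕ) : IsFiniteMeasure (D n) := by
    refine isFiniteMeasure_withDensity_ofReal ?_
    exact (((hd n).integrableOn_Icc (a := 0) (b := 2 * Real.pi)).mono_set Ioc_subset_Icc_self).2
  let M : ℕ → FiniteMeasure (sphere (0 : ℂ) 1) := fun n => ⟨(D n).map e, inferInstance⟩
  have hM (n : ℕ) (w : ℂ) (hw : w ∈ ball (0 : ℂ) 1) :
      ∫ ζ : sphere (0 : ℂ) 1, (1 - ‖w‖ ^ 2) / ‖(ζ : ℂ) - w‖ ^ 2 ∂(M n : Measure _)
        = u (r n * w) := by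
    have hw' : (r n : ℂ) * w ∈ ball (0 : ℂ) (r n) := by
      simp only [mem_ball_zero_iff, norm_mul, norm_real, Real.norm_eq_abs,
        abs_of_pos (hr0 n)] at hw ⊢
      nlinarith [hr0 n]
    have hP := InnerProductSpace.HarmonicOnNhd.circleAverage_poissonKernel_smul
      (fun x hx => hu x (closedBall_subset_ball (hr1 n) hx)) hw'
    rw [← hP, Real.circleAverage_def, intervalIntegral.integral_of_le hpi.le,
      ← integral_smul]
    change ∫ ζ : sphere (0 : ℂ) 1, _ ∂((D n).map e) = _
    rw [integral_map he.aemeasurable (by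
        refine (Measurable.aestronglyMeasurable ?_)
        fun_prop)]
    rw [integral_withDensity_eq_integral_toReal_smul (by have := (hd n).measurable; fun_prop)
      (by simp)]
    refine integral_congr_ae (Eventually.of_forall fun θ => ?_)
    beta_reduce
    rw [ENNReal.toReal_ofReal (hd0 n θ)]
    simp only [smul_eq_mul, Pi.smul_apply', poissonKernel_def,
      sub_zero, e, circleMap_zero, ofReal_one, one_mul, norm_mul, norm_real,
      Real.norm_eq_abs, abs_of_pos (hr0 n), norm_exp_ofReal_mul_I, mul_one]
    rw [← mul_sub, norm_mul, norm_real, Real.norm_eq_abs, abs_of_pos (hr0 n)]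
    have := (hr0 n).ne'
    have hk : (r n ^ 2 - (r n * ‖w‖) ^ 2) / (r n * ‖cexp (θ * I) - w‖) ^ 2
        = (1 - ‖w‖ ^ 2) / ‖cexp (θ * I) - w‖ ^ 2 := by
      rw [mul_pow, mul_pow, ← mul_one_sub, mul_div_mul_left _ _ (pow_ne_zero 2 this)]
    rw [hk]
    ring
  have hmass (n : ℕ) : (M n).mass = (u 0).toNNReal := by
    have : (M n : Measure (sphere (0 : ℂ) 1)).real univ = u 0 := by simpa using hM n 0 (by simp)
    rw [← this, Measure.real, ENNReal.toReal, Real.toNNReal_coe]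
    rfl
  obtain ⟨m, -, hm⟩ := isCompact_iff_ultrafilter_le_nhds'.1
    (isCompact_setOfPred_finiteMeasure_eq_of_compactSpace (sphere (0 : ℂ) 1) (u 0).toNNReal)
    ((hyperfilter ℕ).map M) (by
      rw [Ultrafilter.mem_map]
      exact univ_mem' hmass)
  refine ⟨m, inferInstance, fun w hw => ?_⟩
  have hne (ζ : sphere (0 : ℂ) 1) : ‖(ζ : ℂ) - w‖ ^ 2 ≠ 0 := by
    refine pow_ne_zero 2 (norm_ne_zero_iff.2 (sub_ne_zero.2 ?_))
    rintro rfl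
    simpa using mem_ball_zero_iff.1 hw
  let g : BoundedContinuousFunction (sphere (0 : ℂ) 1) ℝ := BoundedContinuousFunction.mkOfCompact
    ⟨fun ζ => (1 - ‖w‖ ^ 2) / ‖(ζ : ℂ) - w‖ ^ 2, by fun_prop (disch := exact hne _)⟩
  have h1 := (FiniteMeasure.tendsto_iff_forall_integral_tendsto (F := (hyperfilter ℕ : Filter ℕ))).1
    (show Tendsto M _ _ from hm) g
  have h2 : Tendsto (fun n => u (r n * w)) (hyperfilter ℕ : Filter ℕ) (𝓝 (u w)) := by
    have : Tendsto (fun n => (r n : ℂ) * w) atTop (𝓝 w) := by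
      simpa using ((continuous_ofReal.tendsto 1).comp hrlim).mul_const w
    exact ((hu w hw).1.continuousAt.tendsto.comp this).mono_left Nat.hyperfilter_le_atTop
  refine tendsto_nhds_unique h2 (h1.congr fun n => ?_)
  exact hM n w hw

/-- The Cauchy transform of a measure on `ℝ`. -/
noncomputable def cauchyTransform (μ : Measure ℝ) (z : ℂ) : ℂ :=
  ∫ x : ℝ, (z - (x : ℂ))⁻¹ ∂μ

theorem im_le_norm_sub_ofReal (z : ℂ) (x : ℝ) : z.im ≤ ‖z - x‖ := by
  simpa using (le_abs_self _).trans (abs_im_le_norm (z - x))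

theorem sub_ofReal_ne_zero {z : ℂ} (hz : 0 < z.im) (x : ℝ) : z - x ≠ 0 :=
  norm_pos_iff.1 (hz.trans_le (im_le_norm_sub_ofReal z x))

theorem norm_inv_sub_ofReal_le {z : ℂ} (hz : 0 < z.im) (x : ℝ) :
    ‖(z - (x : ℂ))⁻¹‖ ≤ z.im⁻¹ := by
  rw [norm_inv]
  exact inv_anti₀ hz (im_le_norm_sub_ofReal z x)

theorem integrable_inv_sub_ofReal (μ : Measure ℝ) [IsFiniteMeasure μ] {z : ℂ} (hz : 0 < z.im) :
    Integrable (fun x : ℝ => (z - (x : ℂ))⁻¹) μ :=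
  Integrable.of_bound (by fun_prop) z.im⁻¹
    (Eventually.of_forall fun x => norm_inv_sub_ofReal_le hz x)

theorem im_inv_sub_ofReal (z : ℂ) (x : ℝ) :
    ((z - (x : ℂ))⁻¹).im = -(z.im / ‖z - x‖ ^ 2) := by
  rw [inv_im, normSq_eq_norm_sq]
  simp [neg_div]

theorem cauchyTransform_im (μ : Measure ℝ) [IsFiniteMeasure μ] {z : ℂ} (hz : 0 < z.im) :
    (cauchyTransform μ z).im = -∫ x : ℝ, z.im / ‖z - x‖ ^ 2 ∂μ := by
  have h := integral_im (𝕜 := ℂ) (integrable_inv_sub_ofReal μ hz)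
  simp only [RCLike.im_to_complex, im_inv_sub_ofReal, integral_neg] at h
  exact h.symm

theorem cauchyTransform_im_neg (μ : Measure ℝ) [IsProbabilityMeasure μ] {z : ℂ} (hz : 0 < z.im) :
    (cauchyTransform μ z).im < 0 := by
  rw [cauchyTransform_im μ hz, neg_lt_zero]
  have hpos (x : ℝ) : 0 < z.im / ‖z - x‖ ^ 2 :=
    div_pos hz (pow_pos (norm_pos_iff.2 (sub_ofReal_ne_zero hz x)) 2)
  rw [integral_pos_iff_support_of_nonneg (fun x => (hpos x).le)]
  · have : Function.support (fun x : ℝ => z.im / ‖z - x‖ ^ 2) = univ :=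
      eq_univ_of_forall fun x => (hpos x).ne'
    simp [this]
  · refine (integrable_inv_sub_ofReal μ hz).im.neg.congr (Eventually.of_forall fun x => ?_)
    simp only [Pi.neg_apply, RCLike.im_to_complex, im_inv_sub_ofReal, neg_neg]

theorem cauchyTransform_differentiableOn (μ : Measure ℝ) [IsFiniteMeasure μ] :
    DifferentiableOn ℂ (cauchyTransform μ) {z : ℂ | 0 < z.im} := by
  intro z hz
  have hz' : z ∉ algebraMap ℝ ℂ '' μ.support := by
    rintro ⟨x, -, rfl⟩
    simp at hz
  have h := (hasDerivAt_resolventTransform z hz').differentiableAt.neg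
  have e : -resolventTransform μ = cauchyTransform μ := by
    funext w
    simp only [Pi.neg_apply, resolventTransform_apply, cauchyTransform, ← integral_neg, resolvent]
    congr with x
    rw [Ring.inverse_eq_inv', ← inv_neg, neg_sub]
    rfl
  rw [e] at h
  exact h.differentiableWithinAt

/-- Nontangential asymptotics of the Cauchy transform at infinity. -/
theorem tendsto_mul_cauchyTransform (μ : Measure ℝ) [IsFiniteMeasure μ] (K : ℝ) :
    Tendsto (fun z => z * cauchyTransform μ z) (comap im atTop ⊓ 𝓟 {z : ℂ | ‖z‖ ≤ K * z.im})
      (𝓝 (μ.real univ : ℂ)) := by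
  have hint : ∫ _ : ℝ, (1 : ℂ) ∂μ = (μ.real univ : ℂ) := by simp
  rw [← hint]
  have him : Tendsto im (comap im atTop ⊓ 𝓟 {z : ℂ | ‖z‖ ≤ K * z.im}) atTop :=
    tendsto_comap.mono_left inf_le_left
  have hK : ∀ᶠ z : ℂ in comap im atTop ⊓ 𝓟 {z : ℂ | ‖z‖ ≤ K * z.im}, ‖z‖ ≤ K * z.im :=
    mem_inf_of_right (mem_principal_self _)
  have h : Tendsto (fun z : ℂ => ∫ x : ℝ, z * (z - (x : ℂ))⁻¹ ∂μ)
      (comap im atTop ⊓ 𝓟 {z : ℂ | ‖z‖ ≤ K * z.im}) (𝓝 (∫ _ : ℝ, (1 : ℂ) ∂μ)) := by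
    refine tendsto_integral_filter_of_dominated_convergence (fun _ => K)
      (Eventually.of_forall fun z => by fun_prop) ?_ (integrable_const _) ?_
    · filter_upwards [him.eventually_gt_atTop 0, hK] with z hz hzK
      refine Eventually.of_forall fun x => ?_
      rw [norm_mul]
      calc ‖z‖ * ‖(z - (x : ℂ))⁻¹‖ ≤ (K * z.im) * z.im⁻¹ := by
            gcongr
            · exact (norm_nonneg z).trans hzK
            · exact norm_inv_sub_ofReal_le hz x
        _ = K := by field_simp
    · refine Eventually.of_forall fun x => ?_
      rw [← sub_zero (1 : ℂ), tendsto_iff_norm_sub_tendsto_zero]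
      have hlim := (him.inv_tendsto_atTop.const_mul |x|)
      rw [mul_zero] at hlim
      refine squeeze_zero' (Eventually.of_forall fun z => norm_nonneg _) ?_ hlim
      filter_upwards [him.eventually_gt_atTop 0] with z hz
      have : z * (z - (x : ℂ))⁻¹ - (1 - 0) = x * (z - (x : ℂ))⁻¹ := by
        field_simp [sub_ofReal_ne_zero hz x]
        ring
      rw [this, norm_mul, norm_real, Real.norm_eq_abs]
      exact mul_le_mul_of_nonneg_left (norm_inv_sub_ofReal_le hz x) (abs_nonneg x)
  exact h.congr fun z => integral_const_mul _ _

theorem tendsto_imaginary_axis_mul_cauchyTransform (μ : Measure ℝ) [IsFiniteMeasure μ] :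
    Tendsto (fun y : ℝ => (y * I) * cauchyTransform μ (y * I)) atTop (𝓝 (μ.real univ : ℂ)) := by
  refine (tendsto_mul_cauchyTransform μ 1).comp (tendsto_inf.2 ⟨?_, ?_⟩)
  · rw [tendsto_comap_iff]
    exact tendsto_id.congr fun y => by simp
  · rw [tendsto_principal]
    filter_upwards [eventually_ge_atTop 0] with y hy
    simp [abs_of_nonneg hy]

/-- The inverse of an injective holomorphic function on an open set is holomorphic on the image. -/
theorem differentiableOn_image_of_leftInvOn {U : Set ℂ} (hU : IsOpen U) {f g : ℂ → ℂ}
    (hf : DifferentiableOn ℂ f U) (hg : LeftInvOn g f U) :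
    DifferentiableOn ℂ g (f '' U) := by
  have hinj : InjOn f U := hg.injOn
  have han : ∀ z ∈ U, AnalyticAt ℂ f z := fun z hz => hf.analyticAt (hU.mem_nhds hz)
  have hnhds : ∀ z ∈ U, 𝓝 (f z) ≤ map f (𝓝 z) := by
    intro z hz
    refine (han z hz).eventually_constant_or_nhds_le_map_nhds.resolve_left fun h => ?_
    have : ∀ᶠ w in 𝓝 z, w = z := by
      filter_upwards [h, hU.mem_nhds hz] with w hw hwU using hinj hwU hz hw
    have := this.filter_mono (nhdsWithin_le_nhds (s := {z}ᶜ))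
    obtain ⟨w, hw, hw'⟩ := (this.and self_mem_nhdsWithin).exists
    exact hw' hw
  have hgc : ∀ z ∈ U, Tendsto g (𝓝 (f z)) (𝓝 z) := by
    intro z hz
    refine Tendsto.mono_left ?_ (hnhds z hz)
    rw [tendsto_map'_iff]
    refine tendsto_id.congr' ?_
    filter_upwards [hU.mem_nhds hz] with w hw using (hg hw).symm
  have hgcont : ∀ z ∈ U, ContinuousAt g (f z) := fun z hz => by
    simpa only [ContinuousAt, hg hz] using hgc z hz
  have hright : ∀ z ∈ U, ∀ᶠ w in 𝓝 (f z), g w ∈ U ∧ f (g w) = w := by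
    intro z hz
    refine hnhds z hz ?_
    rw [mem_map]
    filter_upwards [hU.mem_nhds hz] with w hw
    simp [hg hw, hw]
  have hdiff : ∀ z ∈ U, deriv f z ≠ 0 → DifferentiableAt ℂ g (f z) := by
    intro z hz hd
    refine (HasDerivAt.of_local_left_inverse (f := f) (f' := deriv f z) (hgcont z hz) ?_ hd
      ((hright z hz).mono fun w hw => hw.2)).differentiableAt
    rw [hg hz]
    exact (han z hz).differentiableAt.hasDerivAt
  rintro _ ⟨z, hz, rfl⟩
  have hd : ∀ᶠ w in 𝓝[≠] z, deriv f w ≠ 0 := by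
    refine (han z hz).deriv.eventually_eq_zero_or_eventually_ne_zero.resolve_left fun h => ?_
    obtain ⟨r, hr, hball⟩ := eventually_nhds_iff_ball.1 (h.and (hU.mem_nhds hz))
    have hmem : z + (r / 2 : ℝ) ∈ ball z r := by
      simp only [mem_ball, dist_self_add_left, norm_real, Real.norm_eq_abs]
      rw [abs_of_pos (by positivity)]
      linarith
    have heq := isOpen_ball.is_const_of_deriv_eq_zero (convex_ball z r).isPreconnected
      (hf.mono fun w hw => (hball w hw).2) (fun w hw => (hball w hw).1) hmem (mem_ball_self hr)
    have := hinj (hball _ hmem).2 hz heq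
    simp [hr.ne'] at this
  refine (analyticAt_of_differentiable_on_punctured_nhds_of_continuousAt ?_
    (hgcont z hz)).differentiableAt.differentiableWithinAt
  have ht : Tendsto g (𝓝[≠] f z) (𝓝[≠] z) := by
    refine tendsto_nhdsWithin_iff.2 ⟨(hgc z hz).mono_left nhdsWithin_le_nhds, ?_⟩
    filter_upwards [(hright z hz).filter_mono nhdsWithin_le_nhds, self_mem_nhdsWithin]
      with w hw hne h
    exact hne (by rw [← hw.2, h]; rfl)
  filter_upwards [ht.eventually hd, (hright z hz).filter_mono nhdsWithin_le_nhds] with w h1 h2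
  simpa only [h2.2] using hdiff (g w) h2.1 h1

theorem add_I_ne_zero {z : ℂ} (hz : 0 < z.im) : z + I ≠ 0 := fun h => by
  have := congrArg im h
  simp at this
  linarith

theorem one_sub_norm_cayley_sq {z : ℂ} (hz : 0 < z.im) :
    1 - ‖(z - I) / (z + I)‖ ^ 2 = 4 * z.im / ‖z + I‖ ^ 2 := by
  have h := add_I_ne_zero hz
  have h' : ‖z + I‖ ^ 2 ≠ 0 := pow_ne_zero 2 (norm_ne_zero_iff.2 h)
  rw [norm_div, div_pow, eq_div_iff h', sub_mul, div_mul_cancel₀ _ h', one_mul,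
    ← normSq_eq_norm_sq, ← normSq_eq_norm_sq, normSq_apply, normSq_apply]
  simp
  ring

theorem cayley_mem_ball {z : ℂ} (hz : 0 < z.im) : (z - I) / (z + I) ∈ ball (0 : ℂ) 1 := by
  have h := add_I_ne_zero hz
  have h1 : 0 < 4 * z.im / ‖z + I‖ ^ 2 := by
    have := norm_pos_iff.2 h
    positivity
  rw [← one_sub_norm_cayley_sq hz] at h1
  rw [mem_ball_zero_iff]
  nlinarith [norm_nonneg ((z - I) / (z + I))]

theorem im_inverse_cayley (w : ℂ) :
    (I * (1 + w) / (1 - w)).im = (1 - ‖w‖ ^ 2) / ‖1 - w‖ ^ 2 := by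
  rw [← normSq_eq_norm_sq, ← normSq_eq_norm_sq, div_im, ← sub_div]
  congr 1
  simp [normSq_apply]
  ring

theorem im_inverse_cayley_pos {w : ℂ} (hw : w ∈ ball (0 : ℂ) 1) :
    0 < (I * (1 + w) / (1 - w)).im := by
  rw [mem_ball_zero_iff] at hw
  have h : 1 - w ≠ 0 := sub_ne_zero.2 fun h => by simp [← h] at hw
  have := norm_pos_iff.2 h
  rw [im_inverse_cayley]
  refine div_pos ?_ (by positivity)
  nlinarith [norm_nonneg w]

theorem inverse_cayley_cayley {z : ℂ} (hz : 0 < z.im) :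
    I * (1 + (z - I) / (z + I)) / (1 - (z - I) / (z + I)) = z := by
  have h := add_I_ne_zero hz
  have e1 : 1 + (z - I) / (z + I) = 2 * z / (z + I) := by field_simp; ring
  have e2 : 1 - (z - I) / (z + I) = 2 * I / (z + I) := by field_simp; ring
  rw [e1, e2]
  field_simp

/-- The Poisson kernel of the disc, expressed in the coordinates of the half-plane. -/
theorem poissonKernel_cayley {z ζ : ℂ} (hz : 0 < z.im) (hζ : ‖ζ‖ = 1) (h1 : ζ ≠ 1) :
    (1 - ‖(z - I) / (z + I)‖ ^ 2) / ‖ζ - (z - I) / (z + I)‖ ^ 2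
      = 4 / ‖1 - ζ‖ ^ 2 * (z.im / ‖z - ((I * (1 + ζ) / (1 - ζ)).re : ℝ)‖ ^ 2) := by
  have h := add_I_ne_zero hz
  have h1' : 1 - ζ ≠ 0 := sub_ne_zero.2 (Ne.symm h1)
  have hre : ((I * (1 + ζ) / (1 - ζ)).re : ℂ) = I * (1 + ζ) / (1 - ζ) :=
    Complex.ext (by simp) (by rw [im_inverse_cayley, hζ]; simp)
  have e : ζ - (z - I) / (z + I)
      = -((z - I * (1 + ζ) / (1 - ζ)) * (1 - ζ) / (z + I)) := by
    field_simp
    ring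
  have h2 := norm_ne_zero_iff.2 h
  have h3 := norm_ne_zero_iff.2 h1'
  have h4 := norm_ne_zero_iff.2 (sub_ofReal_ne_zero hz (I * (1 + ζ) / (1 - ζ)).re)
  rw [hre] at h4
  rw [one_sub_norm_cayley_sq hz, e, hre, norm_neg, norm_div, norm_mul]
  field_simp

/-- Characterization of Cauchy transforms of probability measures. -/
theorem exists_eq_cauchyTransform {G : ℂ → ℂ} (hG : DifferentiableOn ℂ G {z : ℂ | 0 < z.im})
    (him : ∀ z : ℂ, 0 < z.im → (G z).im ≤ 0)
    (hlim : Tendsto (fun y : ℝ => (y * I) * G (y * I)) atTop (𝓝 1)) :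
    ∃ ν : Measure ℝ, IsProbabilityMeasure ν ∧
      ∀ z : ℂ, 0 < z.im → G z = cauchyTransform ν z := by
  have hopen : IsOpen {z : ℂ | 0 < z.im} := isOpen_lt continuous_const continuous_im
  obtain ⟨m, hmfin, hm⟩ := exists_measure_circle_of_harmonicOnNhd
    (u := fun w => (-G (I * (1 + w) / (1 - w))).im) (by
      intro w hw
      have hw' : 1 - w ≠ 0 := sub_ne_zero.2 fun h => by simp [← h] at hw
      refine AnalyticAt.harmonicAt_im (AnalyticAt.neg ?_)
      refine (hG.analyticAt (hopen.mem_nhds (im_inverse_cayley_pos hw))).comp_of_eq ?_ rfl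
      fun_prop (disch := assumption))
    (fun w hw => by simpa using! him _ (im_inverse_cayley_pos hw))
  replace hm (z : ℂ) (hz : 0 < z.im) : -(G z).im = ∫ ζ : sphere (0 : ℂ) 1,
      (1 - ‖(z - I) / (z + I)‖ ^ 2) / ‖(ζ : ℂ) - (z - I) / (z + I)‖ ^ 2 ∂m := by
    rw [← hm _ (cayley_mem_ball hz), inverse_cayley_cayley hz, neg_im]
  have hne (z : ℂ) (hz : 0 < z.im) (ζ : sphere (0 : ℂ) 1) :
      (ζ : ℂ) - (z - I) / (z + I) ≠ 0 := sub_ne_zero.2 fun h => by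
    have h1 := mem_ball_zero_iff.1 (cayley_mem_ball hz)
    rw [← h, norm_eq_of_mem_sphere] at h1
    exact lt_irrefl _ h1
  let d : sphere (0 : ℂ) 1 → ENNReal := fun ζ =>
    ENNReal.ofReal 4 / ENNReal.ofReal (‖1 - (ζ : ℂ)‖ ^ 2)
  have hdm : Measurable d := by fun_prop
  have hd : ∫⁻ ζ, d ζ ∂m ≤ 1 := by
    let k : ℕ → sphere (0 : ℂ) 1 → ℝ := fun n ζ =>
      (1 - ‖((n : ℝ) * I - I) / ((n : ℝ) * I + I)‖ ^ 2) /
        ‖(ζ : ℂ) - ((n : ℝ) * I - I) / ((n : ℝ) * I + I)‖ ^ 2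
    have hk (n : ℕ) (hn : 0 < n) (ζ : sphere (0 : ℂ) 1) :
        n * k n ζ = 4 * ((n : ℝ) / (n + 1)) ^ 2 / ‖(ζ : ℂ) - ((n : ℝ) - 1) / (n + 1)‖ ^ 2 := by
      have e1 : ((n : ℝ) * I - I) / ((n : ℝ) * I + I) = (((n : ℝ) - 1) / (n + 1) : ℂ) := by
        rw [← sub_one_mul, ← add_one_mul, mul_div_mul_right _ _ I_ne_zero, ofReal_natCast]
      have e2 : ‖(n : ℝ) * I + I‖ = (n : ℝ) + 1 := by
        rw [← add_one_mul, norm_mul, norm_I, mul_one]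
        exact_mod_cast RCLike.norm_natCast (K := ℂ) (n + 1)
      have e3 := one_sub_norm_cayley_sq (z := (n : ℝ) * I) (by simpa using hn)
      have e4 : ((n : ℝ) * I).im = n := by simp
      simp only [k]
      rw [e3, e1, e2, e4]
      generalize (n : ℝ) + 1 = s
      ring
    have hlimd (ζ : sphere (0 : ℂ) 1) :
        Tendsto (fun n : ℕ => ENNReal.ofReal (n * k n ζ)) atTop (𝓝 (d ζ)) := by
      have hq : Tendsto (fun n : ℕ => (n : ℝ) / (n + 1)) atTop (𝓝 1) :=
        tendsto_natCast_div_add_atTop 1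
      have hq' : Tendsto (fun n : ℕ => ((n : ℝ) - 1) / (n + 1)) atTop (𝓝 1) := by
        have := (hq.const_mul 2).sub_const 1
        norm_num at this
        refine this.congr fun n => ?_
        field_simp
        ring
      have hnum : Tendsto (fun n : ℕ => ENNReal.ofReal (4 * ((n : ℝ) / (n + 1)) ^ 2)) atTop
          (𝓝 (ENNReal.ofReal 4)) :=
        ENNReal.tendsto_ofReal (by simpa using (hq.pow 2).const_mul 4)
      have hden : Tendsto (fun n : ℕ =>
          ENNReal.ofReal (‖(ζ : ℂ) - (((n : ℝ) - 1) / (n + 1) : ℂ)‖ ^ 2)) atTop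
          (𝓝 (ENNReal.ofReal (‖1 - (ζ : ℂ)‖ ^ 2))) := by
        rw [norm_sub_rev]
        refine ENNReal.tendsto_ofReal ((Tendsto.norm ?_).pow 2)
        refine tendsto_const_nhds.sub ?_
        simpa [Function.comp_def] using (continuous_ofReal.tendsto 1).comp hq'
      refine (ENNReal.Tendsto.div hnum (Or.inl (by simp)) hden (Or.inr (by simp))).congr' ?_
      filter_upwards [eventually_gt_atTop 0] with n hn
      have hpos : 0 < ‖(ζ : ℂ) - (((n : ℝ) - 1) / (n + 1) : ℂ)‖ ^ 2 := by
        have := hne ((n : ℝ) * I) (by simpa using hn) ζ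
        rw [← sub_one_mul, ← add_one_mul, mul_div_mul_right _ _ I_ne_zero] at this
        exact pow_pos (norm_pos_iff.2 this) 2
      rw [hk n hn, ENNReal.ofReal_div_of_pos hpos]
    have hint : Tendsto (fun n : ℕ => ∫⁻ ζ, ENNReal.ofReal (n * k n ζ) ∂m) atTop (𝓝 1) := by
      have h1 : Tendsto (fun n : ℕ => (((n : ℝ) * I) * G ((n : ℝ) * I)).re) atTop (𝓝 1) := by
        simpa [Function.comp_def] using
          (continuous_re.tendsto 1).comp (hlim.comp tendsto_natCast_atTop_atTop)
      have h2 := ENNReal.tendsto_ofReal h1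
      rw [ENNReal.ofReal_one] at h2
      refine h2.congr' ?_
      filter_upwards [eventually_gt_atTop 0] with n hn
      have hz : 0 < ((n : ℝ) * I).im := by simpa using hn
      have hc : Continuous fun ζ => n * k n ζ := by
        have h0 (ζ : sphere (0 : ℂ) 1) :
            ‖(ζ : ℂ) - ((n : ℝ) * I - I) / ((n : ℝ) * I + I)‖ ^ 2 ≠ 0 :=
          pow_ne_zero 2 (norm_ne_zero_iff.2 (hne _ hz ζ))
        fun_prop (disch := exact h0 _)
      rw [← ofReal_integral_eq_lintegral_ofReal
        (hc.integrable_of_hasCompactSupport (HasCompactSupport.of_compactSpace _))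
        (Eventually.of_forall fun ζ => by simp only [hk n hn, Pi.zero_apply]; positivity),
        integral_const_mul]
      congr 1
      have := hm _ hz
      simp only [k]
      rw [← this]
      simp
    have hfatou := lintegral_liminf_le (μ := m) (u := atTop)
      (f := fun (n : ℕ) ζ => ENNReal.ofReal (n * k n ζ))
      (fun n => by fun_prop)
    simp only [(hlimd _).liminf_eq, hint.liminf_eq] at hfatou
    exact hfatou
  have hdfin : ∀ᵐ ζ ∂m, d ζ < ⊤ := ae_lt_top hdm (hd.trans_lt ENNReal.one_lt_top).ne
  let X : sphere (0 : ℂ) 1 → ℝ := fun ζ => (I * (1 + (ζ : ℂ)) / (1 - ζ)).re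
  have hX : Measurable X := by fun_prop
  have : IsFiniteMeasure (m.withDensity d) :=
    isFiniteMeasure_withDensity (hd.trans_lt ENNReal.one_lt_top).ne
  set ν : Measure ℝ := (m.withDensity d).map X with hν
  have hνim (z : ℂ) (hz : 0 < z.im) : (cauchyTransform ν z).im = (G z).im := by
    rw [cauchyTransform_im ν hz, neg_eq_iff_eq_neg, hm z hz, hν, integral_map hX.aemeasurable
      (Measurable.aestronglyMeasurable (by fun_prop)),
      integral_withDensity_eq_integral_toReal_smul hdm hdfin]
    refine integral_congr_ae (hdfin.mono fun ζ hζ => ?_)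
    have h1 : (ζ : ℂ) ≠ 1 := fun h => by
      simp [d, h, ENNReal.div_zero] at hζ
    beta_reduce
    rw [poissonKernel_cayley hz (norm_eq_of_mem_sphere ζ) h1]
    simp [d, X]
  obtain ⟨c, hc⟩ := AnalyticOnNhd.eq_const_of_im_eq_const (f := G - cauchyTransform ν) (c₀ := 0)
    ((hG.sub (cauchyTransform_differentiableOn ν)).analyticOnNhd hopen)
    (fun z hz => by simp [hνim z hz]) hopen
    ⟨⟨I, by simp⟩, (convex_halfSpace_im_gt 0).isPreconnected⟩
  have hsub := hlim.sub (tendsto_imaginary_axis_mul_cauchyTransform ν)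
  have hcy : Tendsto (fun y : ℝ => (y * I) * c) atTop (𝓝 (1 - (ν.real univ : ℂ))) := by
    refine hsub.congr' ?_
    filter_upwards [eventually_gt_atTop 0] with y hy
    rw [← hc (y * I) (by simpa using hy), Pi.sub_apply, mul_sub]
  have hc0 : c = 0 := by
    have h1 : Tendsto (fun y : ℝ => ((y⁻¹ : ℝ) : ℂ)) atTop (𝓝 0) := by
      simpa [Function.comp_def] using (continuous_ofReal.tendsto 0).comp tendsto_inv_atTop_zero
    have h2 := h1.mul hcy
    rw [zero_mul] at h2
    have h3 : Tendsto (fun _ : ℝ => I * c) atTop (𝓝 0) := by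
      refine h2.congr' ?_
      filter_upwards [eventually_gt_atTop 0] with y hy
      have : (y : ℂ) ≠ 0 := by exact_mod_cast hy.ne'
      push_cast
      field_simp
    simpa using tendsto_nhds_unique tendsto_const_nhds h3
  subst hc0
  refine ⟨ν, ⟨?_⟩, fun z hz => sub_eq_zero.1 (hc z hz)⟩
  simp only [mul_zero] at hcy
  have h1 := tendsto_nhds_unique tendsto_const_nhds hcy
  have h2 : ν.real univ = 1 := by exact_mod_cast (sub_eq_zero.1 h1.symm).symm
  rw [measureReal_def] at h2
  exact (ENNReal.toReal_eq_one_iff _).1 h2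

theorem Ftrans_eq_inv_cauchyTransform (μ : Measure ℝ) (z : ℂ) :
    Ftrans μ z = (cauchyTransform μ z)⁻¹ := rfl

theorem Ftrans_map_const_mul (μ : Measure ℝ) {c : ℝ} (hc : c ≠ 0) (z : ℂ) :
    Ftrans (Measure.map (fun x : ℝ => c * x) μ) (c * z) = c * Ftrans μ z := by
  have hc' : (c : ℂ) ≠ 0 := by exact_mod_cast hc
  rw [Ftrans, Ftrans, integral_map (by fun_prop) (Measurable.aestronglyMeasurable (by fun_prop))]
  have h (x : ℝ) : ((c : ℂ) * z - (c * x : ℝ))⁻¹ = (c : ℂ)⁻¹ * (z - x)⁻¹ := by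
    rw [ofReal_mul, ← mul_sub, mul_inv]
  simp only [h]
  rw [integral_const_mul, mul_inv, inv_inv]

theorem Ftrans_differentiableOn (μ : Measure ℝ) [IsProbabilityMeasure μ] :
    DifferentiableOn ℂ (Ftrans μ) {z : ℂ | 0 < z.im} :=
  (cauchyTransform_differentiableOn μ).inv fun z hz h => by
    simpa [h] using cauchyTransform_im_neg μ hz

/-- Nontangential asymptotics of the `F`-transform at infinity. -/
theorem tendsto_Ftrans_div (μ : Measure ℝ) [IsProbabilityMeasure μ] (K : ℝ) :
    Tendsto (fun z => Ftrans μ z / z) (comap im atTop ⊓ 𝓟 {z : ℂ | ‖z‖ ≤ K * z.im}) (𝓝 1) := by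
  have h := (tendsto_mul_cauchyTransform μ K).inv₀ (by simp)
  simp only [probReal_univ, ofReal_one, inv_one] at h
  refine h.congr fun z => ?_
  rw [Ftrans_eq_inv_cauchyTransform, mul_inv, mul_comm, div_eq_mul_inv]

/-- If `f` is injective on the upper half-plane and asymptotic to the identity nontangentially,
then so is its inverse along the dilated image of the imaginary axis. -/
theorem tendsto_div_of_injOn {f w : ℂ → ℂ} {a : ℝ} (ha : 0 < a)
    (hf : DifferentiableOn ℂ f {z : ℂ | 0 < z.im}) (hinj : InjOn f {z : ℂ | 0 < z.im})
    (hasymp : Tendsto (fun z => f z / z) (comap im atTop ⊓ 𝓟 {z : ℂ | ‖z‖ ≤ 3 * z.im}) (𝓝 1))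
    (hw : ∀ z : ℂ, 0 < z.im → 0 < (w z).im ∧ f (w z) = a * f z) :
    Tendsto (fun y : ℝ => w (y * I) / (y * I)) atTop (𝓝 (a : ℂ)) := by
  suffices h : ∀ ε : ℝ, 0 < ε → ε ≤ 1 / 2 →
      ∀ᶠ y : ℝ in atTop, 0 < y ∧ ‖w (y * I) - a * y * I‖ ≤ ε * (a * y) by
    rw [tendsto_iff_norm_sub_tendsto_zero, Metric.tendsto_nhds]
    intro ε hε
    have hη : 0 < min (1 / 2) (ε / (2 * a)) := by positivity
    filter_upwards [h _ hη (min_le_left _ _)] with y ⟨hy, hwy⟩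
    have hyI : (y * I : ℂ) ≠ 0 := by simp [hy.ne']
    have e : w (y * I) / (y * I) - a = (w (y * I) - a * y * I) / (y * I) := by
      rw [sub_div, mul_assoc, mul_div_cancel_right₀ _ hyI]
    rw [Real.dist_eq, sub_zero, abs_norm, e, norm_div, norm_mul, norm_I, mul_one, norm_real,
      Real.norm_eq_abs, abs_of_pos hy, div_lt_iff₀ hy]
    calc _ ≤ min (1 / 2) (ε / (2 * a)) * (a * y) := hwy
      _ ≤ ε / (2 * a) * (a * y) := by gcongr; exact min_le_right _ _
      _ = ε * y / 2 := by field_simp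
      _ < ε * y := half_lt_self (by positivity)
  intro ε hε hε2
  have hev := (Metric.tendsto_nhds.1 hasymp) (ε / 16) (by positivity)
  rw [eventually_inf_principal, eventually_comap, eventually_atTop] at hev
  obtain ⟨T, hT⟩ := hev
  have hclose : ∀ z : ℂ, T ≤ z.im → 0 < z.im → ‖z‖ ≤ 3 * z.im →
      ‖f z - z‖ ≤ ε / 16 * ‖z‖ := by
    intro z h1 h2 h3
    have hz : z ≠ 0 := by rintro rfl; simp at h2
    have h4 := (hT _ h1 z rfl h3).le
    rw [dist_eq_norm, div_sub_one hz, norm_div, div_le_iff₀ (norm_pos_iff.2 hz)] at h4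
    exact h4
  filter_upwards [eventually_gt_atTop 0, eventually_ge_atTop T,
    eventually_ge_atTop (2 * T / a)] with y hy hyT hyT'
  refine ⟨hy, ?_⟩
  rw [div_le_iff₀ ha] at hyT'
  have hay : 0 < a * y := by positivity
  set z₀ : ℂ := a * y * I with hz₀
  have hz₀im : z₀.im = a * y := by simp [hz₀]
  have hz₀n : ‖z₀‖ = a * y := by simp [hz₀, abs_of_pos ha, abs_of_pos hy]
  have hball : ∀ z ∈ closedBall z₀ (ε * (a * y)),
      0 < z.im ∧ ‖f z - z‖ ≤ ε * (a * y) / 8 := by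
    intro z hz
    rw [mem_closedBall, dist_eq_norm] at hz
    have hz' : ‖z - z₀‖ ≤ a * y / 2 := by nlinarith
    have h1 := (abs_im_le_norm (z - z₀)).trans hz'
    rw [sub_im, hz₀im, abs_le] at h1
    have h2 : ‖z‖ ≤ 3 / 2 * (a * y) := by
      have := norm_add_le (z - z₀) z₀
      rw [sub_add_cancel] at this
      linarith
    refine ⟨by linarith, (hclose z (by linarith) (by linarith) (by linarith)).trans ?_⟩
    nlinarith
  have hz₀mem : z₀ ∈ closedBall z₀ (ε * (a * y)) := mem_closedBall_self (by positivity)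
  have hsphere : ∀ z ∈ sphere z₀ (ε * (a * y)), 3 / 4 * (ε * (a * y)) ≤ ‖f z - f z₀‖ := by
    intro z hz
    have h1 := (hball z (sphere_subset_closedBall hz)).2
    have h2 := (hball z₀ hz₀mem).2
    rw [mem_sphere, dist_eq_norm] at hz
    have h3 : ‖z - z₀‖ ≤ ‖f z - f z₀‖ + ‖f z - z‖ + ‖f z₀ - z₀‖ := by
      calc ‖z - z₀‖ = ‖(f z - f z₀) - (f z - z) + (f z₀ - z₀)‖ := by congr 1; ring
        _ ≤ _ := (norm_add_le _ _).trans (by gcongr; exact norm_sub_le _ _)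
    linarith
  have hfreq : ∃ᶠ z in 𝓝 z₀, f z ≠ f z₀ := by
    have : ∀ᶠ z in 𝓝[≠] z₀, f z ≠ f z₀ := by
      filter_upwards [self_mem_nhdsWithin, mem_nhdsWithin_of_mem_nhds
        (closedBall_mem_nhds z₀ (by positivity : 0 < ε * (a * y)))] with z hz hzb h
      exact hz (hinj (hball z hzb).1 (hball z₀ hz₀mem).1 h)
    exact this.frequently.filter_mono nhdsWithin_le_nhds
  have hdiff : DiffContOnCl ℂ f (ball z₀ (ε * (a * y))) := by
    refine (hf.mono ?_).diffContOnCl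
    rw [closure_ball _ (by positivity)]
    exact fun z hz => (hball z hz).1
  have hsub := hdiff.ball_subset_image_closedBall (by positivity) hsphere hfreq
  have hyim : 0 < ((y : ℂ) * I).im := by simpa using hy
  have hynorm : ‖(y : ℂ) * I‖ = y := by simp [abs_of_pos hy]
  obtain ⟨v, hv, hfv⟩ : (a : ℂ) * f (y * I) ∈ f '' closedBall z₀ (ε * (a * y)) := by
    refine hsub ?_
    rw [mem_ball, dist_eq_norm]
    have h1 := hclose (y * I) (by simpa using hyT) hyim (by rw [hynorm]; simp; linarith)
    have h2 := (hball z₀ hz₀mem).2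
    rw [hynorm] at h1
    calc ‖(a : ℂ) * f (y * I) - f z₀‖ = ‖a * (f (y * I) - y * I) - (f z₀ - z₀)‖ := by
          congr 1; rw [hz₀]; ring
      _ ≤ ‖a * (f (y * I) - y * I)‖ + ‖f z₀ - z₀‖ := norm_sub_le _ _
      _ ≤ a * (ε / 16 * y) + ε * (a * y) / 8 := by
          rw [norm_mul, norm_real, Real.norm_eq_abs, abs_of_pos ha]
          gcongr
      _ < 3 / 4 * (ε * (a * y)) / 2 := by nlinarith [mul_pos hε hay]
  have : v = w (y * I) := hinj (hball v hv).1 (hw _ hyim).1 (hfv.trans (hw _ hyim).2.symm)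
  rw [← this, ← dist_eq_norm]
  exact hv

/-- If the `F`-transform of a probability measure `μ` on `ℝ` is injective on the
upper half-plane and starlike with respect to `∞` (i.e. `c·F_μ(ℂ⁺) ⊆ F_μ(ℂ⁺)`
for all `c > 1`), then `μ` is monotonically selfdecomposable: for every
`c ∈ (0,1)` there is a probability measure `ν` with `μ = (D_c μ) ▷ ν`, i.e.
`F_μ = F_{D_c μ} ∘ F_ν`. -/
theorem starlike_implies_monotone_selfdecomposable (μ : Measure ℝ) [IsProbabilityMeasure μ]
    (hinj : Set.InjOn (Ftrans μ) {z : ℂ | 0 < z.im})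
    (hstar : ∀ c : ℝ, 1 < c → ∀ z : ℂ, 0 < z.im →
      ∃ w : ℂ, 0 < w.im ∧ (c : ℂ) * Ftrans μ z = Ftrans μ w) :
    ∀ c : ℝ, c ∈ Set.Ioo (0 : ℝ) 1 → ∃ ν : Measure ℝ, IsProbabilityMeasure ν ∧
      ∀ z : ℂ, 0 < z.im →
        Ftrans μ z = Ftrans (Measure.map (fun x : ℝ => c * x) μ) (Ftrans ν z) := by
  rintro c ⟨hc0, hc1⟩
  have hcC : (c : ℂ) ≠ 0 := by exact_mod_cast hc0.ne'
  set U : Set ℂ := {z : ℂ | 0 < z.im}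
  let g : ℂ → ℂ := Function.invFunOn (Ftrans μ) U
  let w : ℂ → ℂ := fun z => g ((c⁻¹ : ℝ) * Ftrans μ z)
  have hmem : ∀ z ∈ U, ((c⁻¹ : ℝ) : ℂ) * Ftrans μ z ∈ Ftrans μ '' U := fun z hz =>
    let ⟨v, hv, h⟩ := hstar c⁻¹ ((one_lt_inv₀ hc0).2 hc1) z hz
    ⟨v, hv, h.symm⟩
  have hw : ∀ z : ℂ, 0 < z.im → 0 < (w z).im ∧ Ftrans μ (w z) = (c⁻¹ : ℝ) * Ftrans μ z :=
    fun z hz => ⟨Function.invFunOn_mem (hmem z hz), Function.invFunOn_eq (hmem z hz)⟩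
  have hopen : IsOpen U := isOpen_lt continuous_const continuous_im
  have hF := Ftrans_differentiableOn μ
  have hwdiff : DifferentiableOn ℂ w U :=
    (differentiableOn_image_of_leftInvOn hopen hF hinj.leftInvOn_invFunOn).comp
      (hF.const_mul _) hmem
  have hwne : ∀ z ∈ U, (c : ℂ) * w z ≠ 0 := fun z hz h => by
    have := (hw z hz).1
    simp [(mul_eq_zero.1 h).resolve_left hcC] at this
  obtain ⟨ν, hν, hνeq⟩ := exists_eq_cauchyTransform (G := fun z => (c * w z)⁻¹)
    ((hwdiff.const_mul _).inv hwne)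
    (fun z hz => by
      rw [inv_im, im_ofReal_mul]
      exact div_nonpos_of_nonpos_of_nonneg
        (neg_nonpos.2 (mul_pos hc0 (hw z hz).1).le) (normSq_nonneg _))
    (by
      have h := ((tendsto_div_of_injOn (inv_pos.2 hc0) hF hinj (tendsto_Ftrans_div μ 3)
        hw).const_mul (c : ℂ)).inv₀ (by simp [hcC])
      rw [ofReal_inv, mul_inv_cancel₀ hcC, inv_one] at h
      refine h.congr fun y => ?_
      rw [mul_div_assoc', inv_div, div_eq_mul_inv])
  refine ⟨ν, hν, fun z hz => ?_⟩
  rw [Ftrans_eq_inv_cauchyTransform ν, ← hνeq z hz, inv_inv, Ftrans_map_const_mul μ hc0.ne',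
    (hw z hz).2, ofReal_inv, mul_inv_cancel_left₀ hcC]
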